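/- Expansion of the virial functional near W: for d ≥ 3 there is a constant C such that for all v ∈ Ḣ¹(ℝ^d) with ‖∇v‖₂ ≤ 1, K(W + v) = −(2*−2)⟨W^{2*−1}, v⟩ + R(v) with |R(v)| ≤ C‖∇v‖₂². The linear term has no ‖∇v‖₂-linear contribution beyond −(2*−2)⟨W^{2*−1}, v⟩ since K'(W)v = 2⟨∇W,∇v⟩ − 2*⟨W^{2*−1},v⟩ = −(2*−2)⟨W^{2*−1},v⟩ using −ΔW = W^{2*−1}. -/

import Mathlib

open MeasureTheory Real
noncomputable section

abbrev Rd (d : ℕ) := EuclideanSpace ℝ (Fin d)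
/-- critical Sobolev exponent 2* = 2d/(d-2) -/
def pstar (d : ℕ) : ℝ := 2*d/((d:ℝ)-2)
/-- Aubin–Talenti ground state -/
def W (d : ℕ) (x : Rd d) : ℝ := (1 + ‖x‖^2 / ((d:ℝ)*((d:ℝ)-2))) ^ (((2:ℝ)-d)/2)
/-- squared homogeneous H^1 norm -/
def gradSq (d : ℕ) (φ : Rd d → ℝ) : ℝ := ∫ x, ‖gradient φ x‖^2
/-- L^{2*} norm to the power 2* -/
def lpP (d : ℕ) (φ : Rd d → ℝ) : ℝ := ∫ x, |φ x| ^ pstar d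
/-- virial functional K -/
def Kf (d : ℕ) (φ : Rd d → ℝ) : ℝ := gradSq d φ - lpP d φ
/-- static energy J -/
def Jf (d : ℕ) (φ : Rd d → ℝ) : ℝ := (1/2) * gradSq d φ - (1/(pstar d)) * lpP d φ
/-- Laplacian as sum of second partial derivatives -/
def lap (d : ℕ) (f : Rd d → ℝ) (x : Rd d) : ℝ :=
  ∑ i : Fin d, fderiv ℝ (fun y => fderiv ℝ f y (EuclideanSpace.single i 1)) x (EuclideanSpace.single i 1)
/-- H^1-invariant dilation T_λ φ(x) = λ^{d/2-1} φ(λ x) -/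
def Tdil (d : ℕ) (lam : ℝ) (φ : Rd d → ℝ) (x : Rd d) : ℝ := lam ^ ((d:ℝ)/2 - 1) * φ (lam • x)

open Filter Topology Function in
/-- A differentiable function on the line with integrable derivative, some positive power of which is
integrable, tends to zero at both ends. -/
theorem tendsto_zero_of_integrable_deriv_of_integrable_rpow {g g' : ℝ → ℝ} {q : ℝ} (hq : 0 < q)
    (hg : ∀ t, HasDerivAt g (g' t) t) (hg' : Integrable g')
    (hgq : Integrable (fun t => |g t| ^ q)) :
    Tendsto g atBot (𝓝 0) ∧ Tendsto g atTop (𝓝 0) := by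
  have key : ∀ (l : Filter ℝ), (∀ s ∈ l, volume s = ⊤) → ∀ a, Tendsto g l (𝓝 a) → a = 0 := by
    intro l hl a ha
    have h1 : Tendsto (fun t => |g t| ^ q) l (𝓝 (|a| ^ q)) :=
      (ha.abs).rpow_const (Or.inr hq.le)
    have h2 := IntegrableAtFilter.eq_zero_of_tendsto (hgq.integrableAtFilter l) hl h1
    rw [rpow_eq_zero (abs_nonneg a) hq.ne'] at h2
    simpa using h2
  have hbot := tendsto_limUnder_of_hasDerivAt_of_integrableOn_Iic (a := 0)
    (fun x _ => hg x) hg'.integrableOn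
  have htop := tendsto_limUnder_of_hasDerivAt_of_integrableOn_Ioi (a := 0)
    (fun x _ => hg x) hg'.integrableOn
  constructor
  · rwa [key atBot ?_ _ hbot] at hbot
    intro s hs
    obtain ⟨b, hb⟩ := mem_atBot_sets.1 hs
    rw [← top_le_iff, ← volume_Iic (a := b)]
    exact measure_mono hb
  · rwa [key atTop ?_ _ htop] at htop
    intro s hs
    obtain ⟨b, hb⟩ := mem_atTop_sets.1 hs
    rw [← top_le_iff, ← volume_Ici (a := b)]
    exact measure_mono hb

theorem abs_le_integral_abs_deriv {g g' : ℝ → ℝ} {q : ℝ} (hq : 0 < q)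
    (hg : ∀ t, HasDerivAt g (g' t) t) (hg' : Integrable g')
    (hgq : Integrable (fun t => |g t| ^ q)) (t : ℝ) : |g t| ≤ ∫ s, |g' s| := by
  have h := (tendsto_zero_of_integrable_deriv_of_integrable_rpow hq hg hg' hgq).1
  have h1 := integral_Iic_of_hasDerivAt_of_tendsto' (a := t) (fun x _ => hg x) hg'.integrableOn h
  rw [sub_zero] at h1
  rw [← h1]
  calc |∫ s in Set.Iic t, g' s| ≤ ∫ s in Set.Iic t, |g' s| := abs_integral_le_integral_abs
    _ ≤ ∫ s, |g' s| := setIntegral_le_integral hg'.abs (ae_of_all _ fun _ => abs_nonneg _)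

theorem integral_deriv_eq_zero_of_integrable_rpow {g g' : ℝ → ℝ} {q : ℝ} (hq : 0 < q)
    (hg : ∀ t, HasDerivAt g (g' t) t) (hg' : Integrable g')
    (hgq : Integrable (fun t => |g t| ^ q)) : ∫ t, g' t = 0 := by
  have h := tendsto_zero_of_integrable_deriv_of_integrable_rpow hq hg hg' hgq
  simpa using integral_of_hasDerivAt_of_tendsto hg hg' h.1 h.2

/-- An integrable function is integrable along almost every line parallel to an axis. -/
theorem ae_integrable_insertNth {n : ℕ} (i : Fin (n + 1)) {f : (Fin (n + 1) → ℝ) → ℝ}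
    (hf : Integrable f) :
    ∀ᵐ y : Fin n → ℝ, Integrable (fun t : ℝ => f (i.insertNth t y)) := by
  have h := (volume_preserving_piFinSuccAbove (fun _ : Fin (n + 1) => ℝ) i).symm
  have h1 := (h.integrable_comp_emb (MeasurableEquiv.measurableEmbedding _)).2 hf
  exact Integrable.prod_left_ae h1

theorem ae_integrable_update {n : ℕ} (i : Fin (n + 1)) {f : (Fin (n + 1) → ℝ) → ℝ}
    (hf : Integrable f) :
    ∀ᵐ x : Fin (n + 1) → ℝ, Integrable (fun t : ℝ => f (Function.update x i t)) := by
  have h := volume_preserving_piFinSuccAbove (fun _ : Fin (n + 1) => ℝ) i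
  have h1 : Measure.QuasiMeasurePreserving
      (fun x => (MeasurableEquiv.piFinSuccAbove (fun _ : Fin (n + 1) => ℝ) i x).2) volume volume :=
    Measure.quasiMeasurePreserving_snd.comp h.quasiMeasurePreserving
  filter_upwards [h1.ae (ae_integrable_insertNth i hf)] with x hx
  refine hx.congr (ae_of_all _ fun t => ?_)
  exact congrArg f (Fin.insertNth_removeNth i t x)

theorem integral_eq_integral_insertNth {n : ℕ} (i : Fin (n + 1)) {f : (Fin (n + 1) → ℝ) → ℝ}
    (hf : Integrable f) :
    ∫ x, f x = ∫ y : Fin n → ℝ, ∫ t : ℝ, f (i.insertNth t y) := by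
  have h := (volume_preserving_piFinSuccAbove (fun _ : Fin (n + 1) => ℝ) i).symm
  have h1 := (h.integrable_comp_emb (MeasurableEquiv.measurableEmbedding _)).2 hf
  rw [← h.integral_comp (MeasurableEquiv.measurableEmbedding _)]
  exact integral_prod_symm _ h1

theorem hasDerivAt_update_of_partial {n : ℕ} {i : Fin (n + 1)} {F F' : (Fin (n + 1) → ℝ) → ℝ}
    (hF : ∀ x, HasDerivAt (fun t => F (Function.update x i t)) (F' x) (x i))
    (x : Fin (n + 1) → ℝ) (t : ℝ) :
    HasDerivAt (fun s => F (Function.update x i s)) (F' (Function.update x i t)) t := by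
  simpa using hF (Function.update x i t)

/-- The integral of a partial derivative vanishes, when the latter is integrable and some power of
the function is integrable. -/
theorem integral_partial_eq_zero {n : ℕ} (i : Fin (n + 1)) {F F' : (Fin (n + 1) → ℝ) → ℝ}
    {q : ℝ} (hq : 0 < q)
    (hF : ∀ x, HasDerivAt (fun t => F (Function.update x i t)) (F' x) (x i))
    (hF' : Integrable F') (hFq : Integrable (fun x => |F x| ^ q)) : ∫ x, F' x = 0 := by
  rw [integral_eq_integral_insertNth i hF']
  refine integral_eq_zero_of_ae ?_
  filter_upwards [ae_integrable_insertNth i hF', ae_integrable_insertNth i hFq] with y h1 h2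
  refine integral_deriv_eq_zero_of_integrable_rpow hq (fun t => ?_) h1 h2
  simpa using hasDerivAt_update_of_partial hF (i.insertNth 0 y) t

theorem ae_enorm_le_lintegral_partial {n : ℕ} (i : Fin (n + 1)) {F F' : (Fin (n + 1) → ℝ) → ℝ}
    {q : ℝ} (hq : 0 < q)
    (hF : ∀ x, HasDerivAt (fun t => F (Function.update x i t)) (F' x) (x i))
    (hF' : Integrable F') (hFq : Integrable (fun x => |F x| ^ q)) :
    ∀ᵐ x : Fin (n + 1) → ℝ, ‖F x‖ₑ ≤ ∫⁻ t, ‖F' (Function.update x i t)‖ₑ := by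
  filter_upwards [ae_integrable_update i hF', ae_integrable_update i hFq] with x h1 h2
  have h := abs_le_integral_abs_deriv hq (hasDerivAt_update_of_partial hF x) h1 h2 (x i)
  rw [Function.update_eq_self] at h
  rw [← ofReal_integral_norm_eq_lintegral_enorm h1, ← ofReal_norm]
  exact ENNReal.ofReal_le_ofReal h

/-- The Gagliardo–Nirenberg inequality for functions with integrable partial derivatives. -/
theorem lintegral_rpow_le_of_partial_le {n : ℕ} {p : ℝ} (hp : Real.HolderConjugate ((n : ℝ) + 1) p)
    {F : (Fin (n + 1) → ℝ) → ℝ} {F' : Fin (n + 1) → (Fin (n + 1) → ℝ) → ℝ}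
    {G : (Fin (n + 1) → ℝ) → ENNReal} (hG : Measurable G) (hFG : ∀ i x, ‖F' i x‖ₑ ≤ G x)
    {q : ℝ} (hq : 0 < q)
    (hF : ∀ i x, HasDerivAt (fun t => F (Function.update x i t)) (F' i x) (x i))
    (hF' : ∀ i, Integrable (F' i)) (hFq : Integrable (fun x => |F x| ^ q)) :
    ∫⁻ x, ‖F x‖ₑ ^ p ≤ (∫⁻ x, G x) ^ p := by
  have hn : 0 < (n : ℝ) := by linarith [hp.lt]
  have hc : ((Fintype.card (Fin (n + 1)) : ℕ) : ℝ) = n + 1 := by simp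
  calc ∫⁻ x, ‖F x‖ₑ ^ p
      = ∫⁻ x, ∏ _i : Fin (n + 1), ‖F x‖ₑ ^ (1 / (n : ℝ)) := by
        congr! 2 with x
        rw [Finset.prod_const, ← ENNReal.rpow_natCast, ← ENNReal.rpow_mul]
        congr 1
        rw [hp.conjugate_eq]
        simp [field]
    _ ≤ ∫⁻ x, ∏ i, (∫⁻ t, G (Function.update x i t)) ^
          ((1 : ℝ) / ((Fintype.card (Fin (n + 1)) : ℕ) - 1 : ℝ)) := by
        refine lintegral_mono_ae ?_
        have h := ae_all_iff.2 fun i => ae_enorm_le_lintegral_partial i hq (hF i) (hF' i) hFq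
        filter_upwards [h] with x hx
        rw [hc, add_sub_cancel_right]
        gcongr with i
        exact (hx i).trans (lintegral_mono fun t => hFG i _)
    _ ≤ (∫⁻ x, G x) ^ p :=
        lintegral_prod_lintegral_pow_le (fun _ => volume) (by rwa [hc]) hG

theorem measurable_gradient {d : ℕ} (v : Rd d → ℝ) : Measurable (gradient v) :=
  (InnerProductSpace.toDual ℝ (Rd d)).symm.continuous.measurable.comp (measurable_fderiv ℝ v)

theorem HasGradientAt.hasDerivAt_toLp_update {d : ℕ} {f : Rd d → ℝ} {g : Rd d} {x : Fin d → ℝ}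
    (h : HasGradientAt f g (WithLp.toLp 2 x)) (i : Fin d) :
    HasDerivAt (fun t => f (WithLp.toLp 2 (Function.update x i t))) (g i) (x i) := by
  have h1 : HasDerivAt (fun t => (WithLp.toLp 2 (Function.update x i t) : Rd d))
      (EuclideanSpace.single i 1) (x i) := by
    have h2 := PiLp.hasFDerivAt_toLp (𝕜 := ℝ) (E := fun _ : Fin d => ℝ) 2
      (Function.update x i (x i))
    exact h2.comp_hasDerivAt (x i) (hasDerivAt_update x i (x i))
  have h3 : HasFDerivAt f (InnerProductSpace.toDual ℝ (Rd d) g)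
      (WithLp.toLp 2 (Function.update x i (x i))) := by
    rw [Function.update_eq_self]; exact h.hasFDerivAt
  have h4 := h3.comp_hasDerivAt (x i) h1
  have h5 : InnerProductSpace.toDual ℝ (Rd d) g (EuclideanSpace.single i 1) = g i := by
    rw [InnerProductSpace.toDual_apply_apply, EuclideanSpace.inner_single_right]; simp
  rw [h5] at h4
  exact h4

theorem integrable_comp_toLp {d : ℕ} {f : Rd d → ℝ} (hf : Integrable f) :
    Integrable (fun x : Fin d → ℝ => f (WithLp.toLp 2 x)) :=
  ((PiLp.volume_preserving_toLp (Fin d)).integrable_comp_emb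
    (MeasurableEquiv.toLp 2 _).measurableEmbedding).2 hf

theorem integral_comp_toLp {d : ℕ} (f : Rd d → ℝ) :
    ∫ x : Fin d → ℝ, f (WithLp.toLp 2 x) = ∫ x, f x :=
  (PiLp.volume_preserving_toLp (Fin d)).integral_comp
    (MeasurableEquiv.toLp 2 _).measurableEmbedding f

theorem integral_gradient_apply_eq_zero {d : ℕ} (i : Fin d) {F : Rd d → ℝ} {F' : Rd d → Rd d}
    {q : ℝ} (hq : 0 < q) (hF : ∀ x, HasGradientAt F (F' x) x)
    (hF' : Integrable (fun x => F' x i)) (hFq : Integrable (fun x => |F x| ^ q)) :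
    ∫ x, F' x i = 0 := by
  rcases d with _ | n
  · exact i.elim0
  rw [← integral_comp_toLp]
  exact integral_partial_eq_zero i (F := fun x => F (WithLp.toLp 2 x)) hq
    (fun x => (hF _).hasDerivAt_toLp_update i) (integrable_comp_toLp hF') (integrable_comp_toLp hFq)

/-- The Gagliardo–Nirenberg inequality for functions with integrable gradient. -/
theorem lintegral_rpow_le_lintegral_gradient {d : ℕ} {p : ℝ} (hp : Real.HolderConjugate (d : ℝ) p)
    {F : Rd d → ℝ} {F' : Rd d → Rd d} (hF : ∀ x, HasGradientAt F (F' x) x)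
    (hF' : Integrable F') (hm : Measurable F') {q : ℝ} (hq : 0 < q)
    (hFq : Integrable (fun x => |F x| ^ q)) :
    ∫⁻ x, ‖F x‖ₑ ^ p ≤ (∫⁻ x, ‖F' x‖ₑ) ^ p := by
  rcases d with _ | n
  · exact absurd hp.lt (by norm_num)
  have hi : ∀ i, Integrable (fun x => F' x i) := fun i =>
    hF'.mono (by fun_prop) (ae_of_all _ fun x => PiLp.norm_apply_le (F' x) i)
  have h := PiLp.volume_preserving_toLp (Fin (n + 1))
  have he := (MeasurableEquiv.toLp 2 (Fin (n + 1) → ℝ)).measurableEmbedding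
  rw [← h.lintegral_comp_emb he, ← h.lintegral_comp_emb he]
  refine lintegral_rpow_le_of_partial_le (F := fun x => F (WithLp.toLp 2 x))
    (F' := fun i x => F' (WithLp.toLp 2 x) i) (by simpa using hp) ?_ (fun i x => ?_) hq
    (fun i x => (hF _).hasDerivAt_toLp_update i) (fun i => integrable_comp_toLp (hi i))
    (integrable_comp_toLp hFq)
  · exact (hm.comp he.measurable).enorm
  · rw [enorm_le_iff_norm_le]
    exact PiLp.norm_apply_le (F' (WithLp.toLp 2 x)) i

theorem two_lt_pstar {d : ℕ} (hd : 3 ≤ d) : 2 < pstar d := by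
  have h : (3 : ℝ) ≤ d := by exact_mod_cast hd
  rw [pstar, lt_div_iff₀ (by linarith)]
  linarith

theorem integral_mul_le_sqrt_mul_sqrt {α : Type*} [MeasurableSpace α] {μ : Measure α} {f g : α → ℝ}
    (hf0 : 0 ≤ f) (hg0 : 0 ≤ g) (hf : MemLp f 2 μ) (hg : MemLp g 2 μ) :
    ∫ x, f x * g x ∂μ ≤ √(∫ x, f x ^ 2 ∂μ) * √(∫ x, g x ^ 2 ∂μ) := by
  have h2 : ENNReal.ofReal 2 = 2 := by simp
  have h := integral_mul_le_Lp_mul_Lq_of_nonneg (p := 2) (q := 2) (μ := μ)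
    (Real.HolderConjugate.two_two) (ae_of_all _ hf0) (ae_of_all _ hg0)
    (by rwa [h2]) (by rwa [h2])
  simpa only [rpow_two, ← Real.sqrt_eq_rpow] using h

/-- The critical Sobolev inequality. -/
theorem lpP_rpow_le_gradSq {d : ℕ} (hd : 3 ≤ d) {v : Rd d → ℝ} (hv : Differentiable ℝ v)
    (hB : Integrable (fun x => ‖gradient v x‖ ^ 2)) (hA : Integrable (fun x => |v x| ^ pstar d)) :
    lpP d v ^ (2 / pstar d) ≤ (2 * ((d : ℝ) - 1) / (d - 2)) ^ 2 * gradSq d v := by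
  have hd3 : (3 : ℝ) ≤ d := by exact_mod_cast hd
  have hd2 : (0 : ℝ) < d - 2 := by linarith
  have hd1 : (0 : ℝ) < d - 1 := by linarith
  have hp2 := two_lt_pstar hd
  set γ : ℝ := 2 * ((d : ℝ) - 1) / (d - 2) with hγ
  set r : ℝ := (d : ℝ) / (d - 1) with hr
  have hγ1 : 1 < γ := by rw [hγ, lt_div_iff₀ hd2]; linarith
  have hγ0 : 0 < γ := by linarith
  have hr0 : 0 < r := by positivity
  have hγr : γ * r = pstar d := by rw [hγ, hr, pstar]; field_simp
  have hγp : γ - 1 = pstar d / 2 := by rw [hγ, pstar]; field_simp; ring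
  have hconj : Real.HolderConjugate (d : ℝ) r := by
    rw [Real.holderConjugate_iff]
    exact ⟨by linarith, by rw [hr]; field_simp; ring⟩
  have hvm : Measurable v := hv.continuous.measurable
  have hgm := measurable_gradient v
  set F' : Rd d → Rd d := fun x => (γ * |v x| ^ (γ - 2) * v x) • gradient v x with hF'
  have hF : ∀ x, HasGradientAt (fun x => |v x| ^ γ) (F' x) x := by
    intro x
    have h1 := (hasDerivAt_abs_rpow (v x) hγ1).comp_hasFDerivAt x (hv x).hasGradientAt.hasFDerivAt
    rw [hasGradientAt_iff_hasFDerivAt, hF', map_smul]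
    exact h1
  have hF'm : Measurable F' := by fun_prop
  have hnorm : ∀ x, ‖F' x‖ = γ * (|v x| ^ (pstar d / 2) * ‖gradient v x‖) := by
    intro x
    have h2 : |v x| ^ (γ - 2) * |v x| = |v x| ^ (pstar d / 2) := by
      rw [← hγp, ← rpow_add_one' (abs_nonneg _) (by linarith)]
      congr 1; ring
    rw [hF', norm_smul, norm_mul, norm_mul, Real.norm_of_nonneg hγ0.le,
      Real.norm_of_nonneg (by positivity), Real.norm_eq_abs, mul_assoc γ, h2, mul_assoc]
  have hsq : ∀ x, (|v x| ^ (pstar d / 2)) ^ 2 = |v x| ^ pstar d := by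
    intro x
    rw [← rpow_mul_natCast (abs_nonneg _)]
    congr 1; push_cast; ring
  have hm1 : MemLp (fun x => |v x| ^ (pstar d / 2)) 2 volume := by
    rw [memLp_two_iff_integrable_sq (Measurable.aestronglyMeasurable (by fun_prop))]
    simpa only [hsq] using hA
  have hm2 : MemLp (fun x => ‖gradient v x‖) 2 volume := by
    rwa [memLp_two_iff_integrable_sq (Measurable.aestronglyMeasurable (by fun_prop))]
  have hint : Integrable F' := by
    have h3 : Integrable (fun x => γ * (|v x| ^ (pstar d / 2) * ‖gradient v x‖)) :=
      (hm1.integrable_mul hm2).const_mul γ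
    exact h3.mono hF'm.aestronglyMeasurable (ae_of_all _ fun x => by
      rw [hnorm]; exact le_abs_self _)
  have hpow : ∀ x, (|v x| ^ γ) ^ r = |v x| ^ pstar d := by
    intro x
    rw [← rpow_mul (abs_nonneg _), hγr]
  have hmain := lintegral_rpow_le_lintegral_gradient hconj hF hint hF'm hr0
    (by simpa [abs_rpow_of_nonneg, hpow] using hA)
  have hA0 : 0 ≤ lpP d v := integral_nonneg fun x => by positivity
  have hB0 : 0 ≤ gradSq d v := integral_nonneg fun x => by positivity
  have hL : ∫⁻ x, ‖|v x| ^ γ‖ₑ ^ r = ENNReal.ofReal (lpP d v) := by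
    rw [lpP, ofReal_integral_eq_lintegral_ofReal hA (ae_of_all _ fun x => by positivity)]
    refine lintegral_congr fun x => ?_
    rw [Real.enorm_of_nonneg (by positivity), ENNReal.ofReal_rpow_of_nonneg (by positivity) hr0.le,
      hpow]
  have hR : ∫ x, ‖F' x‖ ≤ γ * (√(lpP d v) * √(gradSq d v)) := by
    simp only [hnorm]
    rw [integral_const_mul]
    gcongr
    have := integral_mul_le_sqrt_mul_sqrt (fun x => by positivity) (fun x => by positivity) hm1 hm2
    simp only [hsq] at this
    exact this
  have hreal : lpP d v ≤ (γ * (√(lpP d v) * √(gradSq d v))) ^ r := by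
    rw [hL, ← ofReal_integral_norm_eq_lintegral_enorm hint,
      ENNReal.ofReal_rpow_of_nonneg (integral_nonneg fun x => norm_nonneg _) hr0.le,
      ENNReal.ofReal_le_ofReal_iff (by positivity)] at hmain
    exact hmain.trans (rpow_le_rpow (integral_nonneg fun x => norm_nonneg _) hR hr0.le)
  rcases hA0.eq_or_lt with h0 | hApos
  · rw [← h0, zero_rpow (by positivity)]; positivity
  have h1 := rpow_le_rpow hA0 hreal (z := 2 / r) (by positivity)
  rw [← rpow_mul (by positivity), mul_div_cancel₀ _ hr0.ne', rpow_two, mul_pow, mul_pow,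
    sq_sqrt hA0, sq_sqrt hB0] at h1
  have h2 : 2 / r = 2 / pstar d + 1 := by
    rw [hr, pstar]; field_simp; ring
  rw [h2, rpow_add hApos, rpow_one] at h1
  nlinarith [h1]

/-- The quadratic function of which the ground state `W` is a power. -/
def talentiBase (d : ℕ) (x : Rd d) : ℝ := 1 + ‖x‖ ^ 2 / ((d : ℝ) * ((d : ℝ) - 2))

theorem W_eq (d : ℕ) (x : Rd d) : W d x = talentiBase d x ^ (((2 : ℝ) - d) / 2) := rfl

theorem one_le_talentiBase {d : ℕ} (hd : 3 ≤ d) (x : Rd d) : 1 ≤ talentiBase d x := by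
  have hd3 : (3 : ℝ) ≤ d := by exact_mod_cast hd
  have : 0 ≤ ‖x‖ ^ 2 / ((d : ℝ) * ((d : ℝ) - 2)) :=
    div_nonneg (by positivity) (mul_nonneg (by linarith) (by linarith))
  rw [talentiBase]; linarith

theorem talentiBase_pos {d : ℕ} (hd : 3 ≤ d) (x : Rd d) : 0 < talentiBase d x :=
  one_pos.trans_le (one_le_talentiBase hd x)

theorem W_pos {d : ℕ} (hd : 3 ≤ d) (x : Rd d) : 0 < W d x :=
  rpow_pos_of_pos (talentiBase_pos hd x) _

theorem norm_sq_eq_talentiBase {d : ℕ} (hd : 3 ≤ d) (x : Rd d) :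
    ‖x‖ ^ 2 = d * (d - 2) * (talentiBase d x - 1) := by
  have hd3 : (3 : ℝ) ≤ d := by exact_mod_cast hd
  have hd2 : (d : ℝ) - 2 ≠ 0 := by linarith
  have hd0 : (d : ℝ) ≠ 0 := by linarith
  rw [talentiBase]; field_simp; ring

@[fun_prop]
theorem measurable_talentiBase (d : ℕ) : Measurable (talentiBase d) := by
  unfold talentiBase; fun_prop

@[fun_prop]
theorem measurable_W (d : ℕ) : Measurable (W d) := by
  unfold W; fun_prop

theorem integrable_talentiBase_rpow {d : ℕ} (hd : 3 ≤ d) {e : ℝ} (he : (d : ℝ) < 2 * e) :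
    Integrable (fun x => talentiBase d x ^ (-e)) := by
  have hd3 : (3 : ℝ) ≤ d := by exact_mod_cast hd
  have hD : 1 ≤ (d : ℝ) * (d - 2) := by nlinarith
  have h := integrable_rpow_neg_one_add_norm_sq (E := Rd d) (μ := volume) (r := 2 * e) (by simpa)
  refine (h.const_mul (((d : ℝ) * (d - 2)) ^ e)).mono'
    (Measurable.aestronglyMeasurable (by fun_prop)) (ae_of_all _ fun x => ?_)
  have hs := talentiBase_pos hd x
  have h1 : (1 + ‖x‖ ^ 2) / ((d : ℝ) * (d - 2)) ≤ talentiBase d x := by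
    rw [talentiBase, add_div]
    gcongr
    exact div_le_one_of_le₀ hD (by linarith)
  rw [Real.norm_of_nonneg (by positivity)]
  calc talentiBase d x ^ (-e) ≤ ((1 + ‖x‖ ^ 2) / ((d : ℝ) * (d - 2))) ^ (-e) :=
        rpow_le_rpow_of_nonpos (by positivity) h1 (by linarith)
    _ = ((d : ℝ) * (d - 2)) ^ e * (1 + ‖x‖ ^ 2) ^ (-(2 * e) / 2) := by
        rw [div_rpow (by positivity) (by linarith), rpow_neg (x := (d : ℝ) * (d - 2)) (by linarith),
          show -(2 * e) / 2 = -e by ring]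
        simp [mul_comm]

theorem hasGradientAt_talentiBase_rpow {d : ℕ} (hd : 3 ≤ d) (e : ℝ) (x : Rd d) :
    HasGradientAt (fun x => talentiBase d x ^ e)
      ((2 * e / (d * (d - 2)) * talentiBase d x ^ (e - 1)) • x) x := by
  have h1 : HasFDerivAt (talentiBase d)
      (((d : ℝ) * ((d : ℝ) - 2))⁻¹ • (2 • innerSL ℝ x)) x := by
    have := ((hasStrictFDerivAt_norm_sq x).hasFDerivAt.const_mul
      ((d : ℝ) * ((d : ℝ) - 2))⁻¹).const_add 1
    refine this.congr_of_eventuallyEq (Filter.Eventually.of_forall fun y => ?_)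
    simp only [talentiBase]; ring
  have h2 := h1.rpow_const (p := e) (Or.inl (talentiBase_pos hd x).ne')
  rw [hasGradientAt_iff_hasFDerivAt]
  refine h2.congr_fderiv ?_
  have hd3 : (3 : ℝ) ≤ d := by exact_mod_cast hd
  have hd2 : (d : ℝ) - 2 ≠ 0 := by linarith
  ext y
  simp
  field_simp

/-- The gradient of the ground state. -/
def gradW (d : ℕ) (x : Rd d) : Rd d := (-(1 / d) * talentiBase d x ^ (-(d : ℝ) / 2)) • x

theorem hasGradientAt_W {d : ℕ} (hd : 3 ≤ d) (x : Rd d) : HasGradientAt (W d) (gradW d x) x := by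
  have hd3 : (3 : ℝ) ≤ d := by exact_mod_cast hd
  have hd2 : (d : ℝ) - 2 ≠ 0 := by linarith
  have h := hasGradientAt_talentiBase_rpow hd (((2 : ℝ) - d) / 2) x
  have h1 : 2 * (((2 : ℝ) - d) / 2) / (d * (d - 2)) = -(1 / d) := by field_simp; ring
  have h2 : ((2 : ℝ) - d) / 2 - 1 = -(d : ℝ) / 2 := by ring
  rw [h1, h2] at h
  exact h

@[fun_prop]
theorem measurable_gradW (d : ℕ) : Measurable (gradW d) := by
  unfold gradW; fun_prop

theorem gradient_W {d : ℕ} (hd : 3 ≤ d) (x : Rd d) : gradient (W d) x = gradW d x :=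
  (hasGradientAt_W hd x).gradient

theorem norm_gradW_sq_le {d : ℕ} (hd : 3 ≤ d) (x : Rd d) :
    ‖gradW d x‖ ^ 2 ≤ talentiBase d x ^ (-((d : ℝ) - 1)) := by
  have hd3 : (3 : ℝ) ≤ d := by exact_mod_cast hd
  have hs := talentiBase_pos hd x
  have h1 : (talentiBase d x ^ (-(d : ℝ) / 2)) ^ 2 = talentiBase d x ^ (-(d : ℝ)) := by
    rw [← rpow_mul_natCast hs.le]; congr 1; push_cast; ring
  have h2 : talentiBase d x ^ (-((d : ℝ) - 1)) = talentiBase d x ^ (-(d : ℝ)) * talentiBase d x := by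
    rw [← rpow_add_one hs.ne']; congr 1; ring
  rw [gradW, norm_smul, mul_pow, Real.norm_eq_abs, sq_abs, mul_pow, h1, norm_sq_eq_talentiBase hd,
    h2, neg_sq, mul_comm ((1 / (d : ℝ)) ^ 2), mul_assoc]
  gcongr
  have h3 : (1 / (d : ℝ)) ^ 2 * (d * (d - 2) * (talentiBase d x - 1))
      = (1 - 2 / d) * (talentiBase d x - 1) := by field_simp
  have h4 : 0 ≤ 2 / (d : ℝ) := by positivity
  have h5 := one_le_talentiBase hd x
  rw [h3]
  nlinarith

theorem norm_gradW_le_one {d : ℕ} (hd : 3 ≤ d) (x : Rd d) : ‖gradW d x‖ ≤ 1 := by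
  have hd3 : (3 : ℝ) ≤ d := by exact_mod_cast hd
  have h1 : talentiBase d x ^ (-((d : ℝ) - 1)) ≤ 1 :=
    rpow_le_one_of_one_le_of_nonpos (one_le_talentiBase hd x) (by linarith)
  exact (sq_le_one_iff₀ (norm_nonneg _)).1 ((norm_gradW_sq_le hd x).trans h1)

theorem integrable_norm_gradW_sq {d : ℕ} (hd : 3 ≤ d) : Integrable (fun x => ‖gradW d x‖ ^ 2) := by
  have hd3 : (3 : ℝ) ≤ d := by exact_mod_cast hd
  refine (integrable_talentiBase_rpow hd (e := (d : ℝ) - 1) (by linarith)).mono'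
    (Measurable.aestronglyMeasurable (by fun_prop)) (ae_of_all _ fun x => ?_)
  rw [Real.norm_of_nonneg (by positivity)]
  exact norm_gradW_sq_le hd x

theorem W_rpow_pstar {d : ℕ} (hd : 3 ≤ d) (x : Rd d) :
    W d x ^ pstar d = talentiBase d x ^ (-(d : ℝ)) := by
  have hd3 : (3 : ℝ) ≤ d := by exact_mod_cast hd
  have hd2 : (d : ℝ) - 2 ≠ 0 := by linarith
  rw [W_eq, ← rpow_mul (talentiBase_pos hd x).le, pstar]
  congr 1; field_simp; ring

theorem W_rpow_pstar_sub_one {d : ℕ} (hd : 3 ≤ d) (x : Rd d) :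
    W d x ^ (pstar d - 1) = talentiBase d x ^ (-(d : ℝ) / 2 - 1) := by
  have hd3 : (3 : ℝ) ≤ d := by exact_mod_cast hd
  have hd2 : (d : ℝ) - 2 ≠ 0 := by linarith
  rw [W_eq, ← rpow_mul (talentiBase_pos hd x).le, pstar]
  congr 1; field_simp; ring

theorem integrable_W_rpow_pstar {d : ℕ} (hd : 3 ≤ d) : Integrable (fun x => W d x ^ pstar d) := by
  have hd3 : (3 : ℝ) ≤ d := by exact_mod_cast hd
  simp only [W_rpow_pstar hd]
  exact integrable_talentiBase_rpow hd (by linarith)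

theorem integrable_talentiBase_rpow_mul {d : ℕ} (hd : 3 ≤ d) {v : Rd d → ℝ} (hv : Measurable v)
    (hA : Integrable (fun x => |v x| ^ pstar d)) :
    Integrable (fun x => talentiBase d x ^ (-(d : ℝ) / 2) * |v x|) := by
  have hd3 : (3 : ℝ) ≤ d := by exact_mod_cast hd
  have hp2 := two_lt_pstar hd
  set q := Real.conjExponent (pstar d)
  have hpq : Real.HolderConjugate (pstar d) q := Real.HolderConjugate.conjExponent (by linarith)
  have hq1 := hpq.symm.lt
  have h1 : Integrable (fun x => talentiBase d x ^ (-((d : ℝ) / 2 * q))) :=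
    integrable_talentiBase_rpow hd (by nlinarith)
  refine ((h1.div_const q).add (hA.div_const (pstar d))).mono'
    (Measurable.aestronglyMeasurable (by fun_prop)) (ae_of_all _ fun x => ?_)
  have hs := talentiBase_pos hd x
  rw [Real.norm_of_nonneg (by positivity)]
  have h2 := Real.young_inequality_of_nonneg (a := talentiBase d x ^ (-(d : ℝ) / 2)) (b := |v x|)
    (by positivity) (abs_nonneg _) hpq.symm
  rw [← rpow_mul hs.le, show -(d : ℝ) / 2 * q = -((d : ℝ) / 2 * q) by ring] at h2
  exact h2

theorem integrable_W_rpow_mul {d : ℕ} (hd : 3 ≤ d) {v : Rd d → ℝ} (hv : Measurable v)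
    (hA : Integrable (fun x => |v x| ^ pstar d)) :
    Integrable (fun x => W d x ^ (pstar d - 1) * v x) := by
  refine (integrable_talentiBase_rpow_mul hd hv hA).mono'
    (Measurable.aestronglyMeasurable (by fun_prop)) (ae_of_all _ fun x => ?_)
  have hs := talentiBase_pos hd x
  rw [W_rpow_pstar_sub_one hd, norm_mul, Real.norm_of_nonneg (by positivity), Real.norm_eq_abs]
  gcongr
  · exact one_le_talentiBase hd x
  · linarith

theorem integrable_inner_gradW {d : ℕ} (hd : 3 ≤ d) {v : Rd d → ℝ}
    (hB : Integrable (fun x => ‖gradient v x‖ ^ 2)) :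
    Integrable (fun x => ‖gradW d x‖ * ‖gradient v x‖) := by
  have hgm := measurable_gradient v
  refine ((integrable_norm_gradW_sq hd).add hB).mono'
    (Measurable.aestronglyMeasurable (by fun_prop)) (ae_of_all _ fun x => ?_)
  rw [Real.norm_of_nonneg (by positivity), Pi.add_apply]
  nlinarith [sq_nonneg (‖gradW d x‖ - ‖gradient v x‖), norm_nonneg (gradW d x),
    norm_nonneg (gradient v x)]

theorem HasGradientAt.mul_real {E : Type*} [NormedAddCommGroup E] [InnerProductSpace ℝ E]
    [CompleteSpace E] {f g : E → ℝ} {f' g' x : E} (hf : HasGradientAt f f' x)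
    (hg : HasGradientAt g g' x) :
    HasGradientAt (fun x => f x * g x) (g x • f' + f x • g') x := by
  rw [hasGradientAt_iff_hasFDerivAt]
  refine (hf.hasFDerivAt.mul hg.hasFDerivAt).congr_fderiv ?_
  rw [map_add, map_smul, map_smul, add_comm]

/-- The weak form of the equation `-ΔW = W ^ (2* - 1)`. -/
theorem integral_inner_gradW {d : ℕ} (hd : 3 ≤ d) {v : Rd d → ℝ} (hv : Differentiable ℝ v)
    (hB : Integrable (fun x => ‖gradient v x‖ ^ 2)) (hA : Integrable (fun x => |v x| ^ pstar d)) :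
    ∫ x, inner ℝ (gradW d x) (gradient v x) = ∫ x, W d x ^ (pstar d - 1) * v x := by
  have hd3 : (3 : ℝ) ≤ d := by exact_mod_cast hd
  have hd2 : 0 < (d : ℝ) - 2 := by linarith
  have hp2 := two_lt_pstar hd
  have hvm : Measurable v := hv.continuous.measurable
  have hgm := measurable_gradient v
  let H : Fin d → Rd d → Rd d := fun i x =>
    (-(1 / d) * talentiBase d x ^ (-(d : ℝ) / 2)) • EuclideanSpace.single i (1 : ℝ)
      + (x i / (d * (d - 2)) * talentiBase d x ^ (-(d : ℝ) / 2 - 1)) • x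
  have hH : ∀ i x, HasGradientAt (fun x => gradW d x i) (H i x) x := by
    intro i x
    have h1 := (hasGradientAt_talentiBase_rpow hd (-(d : ℝ) / 2) x).hasFDerivAt.const_mul (-(1 / (d : ℝ)))
    have h2 : HasFDerivAt (fun x : Rd d => x i) (EuclideanSpace.proj i : Rd d →L[ℝ] ℝ) x :=
      (EuclideanSpace.proj i : Rd d →L[ℝ] ℝ).hasFDerivAt
    rw [hasGradientAt_iff_hasFDerivAt]
    refine (h1.mul h2).congr_fderiv ?_
    ext y
    simp [H, EuclideanSpace.inner_single_left]
    field_simp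
  have hHi : ∀ i x, H i x i = -(1 / d) * talentiBase d x ^ (-(d : ℝ) / 2)
      + (x i) ^ 2 / (d * (d - 2)) * talentiBase d x ^ (-(d : ℝ) / 2 - 1) := by
    intro i x
    simp [H]; ring
  have hHsum : ∀ x, ∑ i, H i x i = -W d x ^ (pstar d - 1) := by
    intro x
    have hs := talentiBase_pos hd x
    simp only [hHi]
    rw [Finset.sum_add_distrib, ← Finset.sum_mul _ (fun i => (x i) ^ 2 / ((d : ℝ) * (d - 2))),
      ← Finset.sum_div, ← EuclideanSpace.real_norm_sq_eq,
      norm_sq_eq_talentiBase hd, W_rpow_pstar_sub_one hd, rpow_sub_one hs.ne']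
    simp
    field_simp
    ring
  have hHb : ∀ i x, |H i x i| ≤ 2 * talentiBase d x ^ (-(d : ℝ) / 2) := by
    intro i x
    have hs := talentiBase_pos hd x
    have h1 : (x i) ^ 2 ≤ ‖x‖ ^ 2 := by
      rw [← sq_abs]; gcongr; exact PiLp.norm_apply_le x i
    rw [norm_sq_eq_talentiBase hd] at h1
    have h2 : (x i) ^ 2 / (d * (d - 2)) ≤ talentiBase d x := by
      rw [div_le_iff₀ (by positivity)]; nlinarith [mul_pos (by linarith : 0 < (d : ℝ)) hd2]
    have h3 : (x i) ^ 2 / (d * (d - 2)) * talentiBase d x ^ (-(d : ℝ) / 2 - 1)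
        ≤ talentiBase d x ^ (-(d : ℝ) / 2) := by
      calc _ ≤ talentiBase d x * talentiBase d x ^ (-(d : ℝ) / 2 - 1) := by gcongr
        _ = _ := by rw [mul_comm, ← rpow_add_one hs.ne']; congr 1; ring
    have h4 : 1 / (d : ℝ) ≤ 1 := by rw [div_le_one (by positivity)]; linarith
    have h5 : 0 < talentiBase d x ^ (-(d : ℝ) / 2) := by positivity
    have h6 : 0 ≤ (x i) ^ 2 / (d * (d - 2)) * talentiBase d x ^ (-(d : ℝ) / 2 - 1) := by positivity
    rw [hHi]
    refine (abs_add_le _ _).trans ?_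
    rw [abs_mul, abs_neg, abs_of_pos h5, abs_of_nonneg h6, abs_of_nonneg (by positivity)]
    nlinarith
  have hI1 : ∀ i, Integrable (fun x => H i x i * v x) := by
    intro i
    refine ((integrable_talentiBase_rpow_mul hd hvm hA).const_mul 2).mono' ?_
      (ae_of_all _ fun x => ?_)
    · simp only [hHi]
      exact Measurable.aestronglyMeasurable (by fun_prop)
    · rw [norm_mul, Real.norm_eq_abs, Real.norm_eq_abs, ← mul_assoc]
      gcongr
      exact hHb i x
  have hI2 : ∀ i, Integrable (fun x => gradW d x i * gradient v x i) := by
    intro i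
    refine (integrable_inner_gradW hd hB).mono'
      (Measurable.aestronglyMeasurable (by fun_prop)) (ae_of_all _ fun x => ?_)
    rw [norm_mul]
    gcongr
    · exact PiLp.norm_apply_le _ i
    · exact PiLp.norm_apply_le _ i
  have hzero : ∀ i, ∫ x, (H i x i * v x + gradW d x i * gradient v x i) = 0 := by
    intro i
    have h1 : ∀ x, HasGradientAt (fun x => gradW d x i * v x)
        (v x • H i x + gradW d x i • gradient v x) x := by
      intro x
      rw [hasGradientAt_iff_hasFDerivAt]
      exact (hH i x).mul_real (hv x).hasGradientAt
    have h2 : ∀ x, (v x • H i x + gradW d x i • gradient v x) i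
        = H i x i * v x + gradW d x i * gradient v x i := by
      intro x; simp [mul_comm]
    have h3 := integral_gradient_apply_eq_zero i (q := pstar d) (by linarith) h1
      (by simp only [h2]; exact (hI1 i).add (hI2 i)) ?_
    · simpa only [h2] using h3
    · refine hA.mono' (Measurable.aestronglyMeasurable (by fun_prop)) (ae_of_all _ fun x => ?_)
      rw [Real.norm_of_nonneg (by positivity), abs_mul]
      gcongr
      exact mul_le_of_le_one_left (abs_nonneg _)
        ((PiLp.norm_apply_le (gradW d x) i).trans (norm_gradW_le_one hd x))
  have h1 : ∑ i, ∫ x, (H i x i * v x + gradW d x i * gradient v x i) = 0 :=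
    Finset.sum_eq_zero fun i _ => hzero i
  have hI : ∀ i ∈ Finset.univ,
      Integrable (fun x => H i x i * v x + gradW d x i * gradient v x i) :=
    fun i _ => (hI1 i).add (hI2 i)
  rw [← integral_finsetSum _ hI] at h1
  have h2 : ∀ x, ∑ i, (H i x i * v x + gradW d x i * gradient v x i)
      = inner ℝ (gradW d x) (gradient v x) - W d x ^ (pstar d - 1) * v x := by
    intro x
    rw [Finset.sum_add_distrib, ← Finset.sum_mul, hHsum, PiLp.inner_apply]
    simp [mul_comm]
    ring
  simp only [h2] at h1
  have h3 : Integrable (fun x => inner ℝ (gradW d x) (gradient v x)) := by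
    refine (integrable_inner_gradW hd hB).mono'
      (Measurable.aestronglyMeasurable (by fun_prop)) (ae_of_all _ fun x => norm_inner_le_norm _ _)
  rw [integral_sub h3 (integrable_W_rpow_mul hd hvm hA)] at h1
  linarith

theorem rpow_tangent_le {p x z : ℝ} (hp : 1 ≤ p) (hx : 0 ≤ x) (hz : 0 < z) :
    z ^ p + p * z ^ (p - 1) * (x - z) ≤ x ^ p := by
  have h1 : -1 ≤ x / z - 1 := by linarith [div_nonneg hx hz.le]
  have h := one_add_mul_self_le_rpow_one_add h1 hp
  rw [add_sub_cancel, div_rpow hx hz.le, le_div_iff₀ (by positivity)] at h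
  refine le_trans (le_of_eq ?_) h
  rw [rpow_sub_one hz.ne']
  field_simp

theorem rpow_sub_rpow_mul_le {q a c m : ℝ} (hq : 1 ≤ q) (ha : 0 < a) (hc : 0 < c) (ham : a ≤ m)
    (hcm : c ≤ m) : (c ^ q - a ^ q) * (c - a) ≤ q * m ^ (q - 1) * (c - a) ^ 2 := by
  have h1 := rpow_tangent_le hq hc.le ha
  have h2 := rpow_tangent_le hq ha.le hc
  have h3 : a ^ (q - 1) ≤ m ^ (q - 1) := rpow_le_rpow ha.le ham (by linarith)
  have h4 : c ^ (q - 1) ≤ m ^ (q - 1) := rpow_le_rpow hc.le hcm (by linarith)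
  rcases le_total a c with h | h
  · have h5 : c ^ q - a ^ q ≤ q * c ^ (q - 1) * (c - a) := by linarith
    calc (c ^ q - a ^ q) * (c - a) ≤ (q * c ^ (q - 1) * (c - a)) * (c - a) := by
          gcongr
      _ = q * c ^ (q - 1) * (c - a) ^ 2 := by ring
      _ ≤ _ := by gcongr
  · have h5 : a ^ q - c ^ q ≤ q * a ^ (q - 1) * (a - c) := by linarith
    calc (c ^ q - a ^ q) * (c - a) = (a ^ q - c ^ q) * (a - c) := by ring
      _ ≤ (q * a ^ (q - 1) * (a - c)) * (a - c) := by gcongr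
      _ = q * a ^ (q - 1) * (c - a) ^ 2 := by ring
      _ ≤ _ := by gcongr

/-- The constant in the second order expansion of `|a + b| ^ p`. -/
def taylorConst (p : ℝ) : ℝ := 3 ^ p + 2 ^ p + p * 2 ^ (p - 1) + p * (p - 1) * 2 ^ (p - 2)

theorem taylorConst_nonneg {p : ℝ} (hp : 2 < p) : 0 ≤ taylorConst p := by
  have : 0 < p - 1 := by linarith
  have : 0 < p := by linarith
  unfold taylorConst; positivity

theorem abs_rpow_add_sub_le {p a : ℝ} (hp : 2 < p) (ha : 0 < a) (b : ℝ) :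
    |(|a + b| ^ p - a ^ p - p * (a ^ (p - 1) * b))|
      ≤ taylorConst p * (a ^ (p - 2) * |b| ^ (2 : ℝ) + |b| ^ p) := by
  have hp0 : 0 < p := by linarith
  have hp1 : 0 < p - 1 := by linarith
  have hb2 : 0 ≤ a ^ (p - 2) * |b| ^ (2 : ℝ) := by positivity
  have hbp : 0 ≤ |b| ^ p := by positivity
  rcases le_or_gt a (2 * |b|) with h | h
  · have hb : 0 < |b| := by linarith
    have h1 : |a + b| ^ p ≤ 3 ^ p * |b| ^ p := by
      rw [← mul_rpow (by norm_num) hb.le]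
      refine rpow_le_rpow (abs_nonneg _) ?_ hp0.le
      have := abs_add_le a b
      rw [abs_of_pos ha] at this
      linarith
    have h2 : a ^ p ≤ 2 ^ p * |b| ^ p := by
      rw [← mul_rpow (by norm_num) hb.le]
      exact rpow_le_rpow ha.le h hp0.le
    have h3 : p * (a ^ (p - 1) * |b|) ≤ p * 2 ^ (p - 1) * |b| ^ p := by
      have h4 : a ^ (p - 1) ≤ 2 ^ (p - 1) * |b| ^ (p - 1) := by
        rw [← mul_rpow (by norm_num) hb.le]
        exact rpow_le_rpow ha.le h hp1.le
      calc p * (a ^ (p - 1) * |b|) ≤ p * (2 ^ (p - 1) * |b| ^ (p - 1) * |b|) := by gcongr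
        _ = p * 2 ^ (p - 1) * |b| ^ p := by
          rw [rpow_sub_one hb.ne' p]; field_simp
    have h5 : |p * (a ^ (p - 1) * b)| = p * (a ^ (p - 1) * |b|) := by
      rw [abs_mul, abs_mul, abs_of_pos hp0, abs_of_pos (by positivity : 0 < a ^ (p - 1))]
    calc _ ≤ |(|a + b| ^ p)| + |a ^ p| + |p * (a ^ (p - 1) * b)| :=
          (abs_sub _ _).trans (add_le_add_left (abs_sub _ _) _)
      _ ≤ 3 ^ p * |b| ^ p + 2 ^ p * |b| ^ p + p * 2 ^ (p - 1) * |b| ^ p := by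
          rw [abs_of_nonneg (rpow_nonneg (abs_nonneg (a + b)) p), abs_of_nonneg (rpow_nonneg ha.le p),
            h5]
          exact add_le_add (add_le_add h1 h2) h3
      _ = (3 ^ p + 2 ^ p + p * 2 ^ (p - 1)) * |b| ^ p := by ring
      _ ≤ taylorConst p * |b| ^ p := by
          gcongr
          rw [taylorConst]
          exact le_add_of_nonneg_right (by positivity)
      _ ≤ _ := by
          gcongr
          · exact taylorConst_nonneg hp
          · linarith
  · have hc : 0 < a + b := by linarith [neg_abs_le b]
    have hc2 : a + b ≤ 2 * a := by linarith [le_abs_self b, abs_nonneg b]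
    have h1 := rpow_tangent_le (p := p) (by linarith) hc.le ha
    have h2 := rpow_tangent_le (p := p) (by linarith) ha.le hc
    have h3 := rpow_sub_rpow_mul_le (q := p - 1) (m := 2 * a) (by linarith) ha hc (by linarith) hc2
    rw [add_sub_cancel_left] at h1 h3
    rw [abs_of_pos hc, abs_of_nonneg (by linarith)]
    calc (a + b) ^ p - a ^ p - p * (a ^ (p - 1) * b)
        ≤ p * (((a + b) ^ (p - 1) - a ^ (p - 1)) * b) := by linarith
      _ ≤ p * ((p - 1) * (2 * a) ^ (p - 1 - 1) * b ^ 2) := by gcongr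
      _ = p * (p - 1) * 2 ^ (p - 2) * (a ^ (p - 2) * |b| ^ (2 : ℝ)) := by
          rw [rpow_two, sq_abs, mul_rpow (by norm_num) ha.le, show p - 1 - 1 = p - 2 by ring]; ring
      _ ≤ taylorConst p * (a ^ (p - 2) * |b| ^ (2 : ℝ)) := by
          gcongr
          rw [taylorConst]
          exact le_add_of_nonneg_left (by positivity)
      _ ≤ _ := by
          gcongr
          · exact taylorConst_nonneg hp
          · linarith

theorem memLp_of_integrable_rpow {α : Type*} [MeasurableSpace α] {μ : Measure α} {p : ℝ}
    (hp : 0 < p) {f : α → ℝ} (hf : AEStronglyMeasurable f μ) (hf0 : ∀ x, 0 ≤ f x)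
    (hi : Integrable (fun x => f x ^ p) μ) : MemLp f (ENNReal.ofReal p) μ := by
  rw [← integrable_norm_rpow_iff hf (by simpa) ENNReal.ofReal_ne_top, ENNReal.toReal_ofReal hp.le]
  simpa only [Real.norm_of_nonneg (hf0 _)] using hi

theorem integrable_mul_and_integral_mul_le {α : Type*} [MeasurableSpace α] {μ : Measure α} {p q : ℝ}
    (hpq : p.HolderConjugate q) {f g : α → ℝ} (hf : AEStronglyMeasurable f μ)
    (hg : AEStronglyMeasurable g μ) (hf0 : ∀ x, 0 ≤ f x) (hg0 : ∀ x, 0 ≤ g x)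
    (hfi : Integrable (fun x => f x ^ p) μ) (hgi : Integrable (fun x => g x ^ q) μ) :
    Integrable (fun x => f x * g x) μ ∧
      ∫ x, f x * g x ∂μ ≤ (∫ x, f x ^ p ∂μ) ^ (1 / p) * (∫ x, g x ^ q ∂μ) ^ (1 / q) := by
  have h1 := memLp_of_integrable_rpow hpq.pos hf hf0 hfi
  have h2 := memLp_of_integrable_rpow hpq.symm.pos hg hg0 hgi
  have := hpq.ennrealOfReal
  exact ⟨h1.integrable_mul h2,
    integral_mul_le_Lp_mul_Lq_of_nonneg hpq (ae_of_all _ hf0) (ae_of_all _ hg0) h1 h2⟩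

theorem integrable_and_integral_W_rpow_mul_sq_le {d : ℕ} (hd : 3 ≤ d) {v : Rd d → ℝ}
    (hv : Measurable v) (hA : Integrable (fun x => |v x| ^ pstar d)) :
    Integrable (fun x => W d x ^ (pstar d - 2) * |v x| ^ (2 : ℝ)) ∧
      ∫ x, W d x ^ (pstar d - 2) * |v x| ^ (2 : ℝ) ≤
        lpP d (W d) ^ ((pstar d - 2) / pstar d) * lpP d v ^ (2 / pstar d) := by
  have hp2 := two_lt_pstar hd
  have hp0 : 0 < pstar d - 2 := by linarith
  have hp : pstar d ≠ 0 := by linarith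
  have hconj : (pstar d / (pstar d - 2)).HolderConjugate (pstar d / 2) := by
    rw [Real.holderConjugate_iff]
    refine ⟨by rw [lt_div_iff₀ hp0]; linarith, ?_⟩
    field_simp
    ring
  have h1 : ∀ x, (W d x ^ (pstar d - 2)) ^ (pstar d / (pstar d - 2)) = |W d x| ^ pstar d := by
    intro x
    rw [← rpow_mul (W_pos hd x).le, abs_of_pos (W_pos hd x)]
    congr 1; field_simp
  have h2 : ∀ x, (|v x| ^ (2 : ℝ)) ^ (pstar d / 2) = |v x| ^ pstar d := by
    intro x
    rw [← rpow_mul (abs_nonneg _)]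
    congr 1; field_simp
  have h := integrable_mul_and_integral_mul_le (μ := (volume : Measure (Rd d))) hconj
    (f := fun x => W d x ^ (pstar d - 2)) (g := fun x => |v x| ^ (2 : ℝ))
    (Measurable.aestronglyMeasurable (by fun_prop)) (Measurable.aestronglyMeasurable (by fun_prop))
    (fun x => rpow_nonneg (W_pos hd x).le _) (fun x => by positivity)
    (by simpa only [h1, abs_of_pos (W_pos hd _)] using integrable_W_rpow_pstar hd)
    (by simpa only [h2] using hA)
  simp only [h1, h2, one_div_div] at h
  exact h

theorem gradSq_W_add {d : ℕ} (hd : 3 ≤ d) {v : Rd d → ℝ} (hv : Differentiable ℝ v)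
    (hB : Integrable (fun x => ‖gradient v x‖ ^ 2)) (hA : Integrable (fun x => |v x| ^ pstar d)) :
    gradSq d (fun x => W d x + v x)
      = lpP d (W d) + 2 * (∫ x, W d x ^ (pstar d - 1) * v x) + gradSq d v := by
  have hp2 := two_lt_pstar hd
  have hgm := measurable_gradient v
  have hW : ∫ x, ‖gradW d x‖ ^ 2 = lpP d (W d) := by
    have h := integral_inner_gradW hd (v := W d)
      (fun x => (hasGradientAt_W hd x).differentiableAt)
      (by simpa only [gradient_W hd] using integrable_norm_gradW_sq hd)
      (by simpa only [abs_of_pos (W_pos hd _)] using integrable_W_rpow_pstar hd)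
    simp only [gradient_W hd, real_inner_self_eq_norm_sq] at h
    rw [h, lpP]
    congr 1 with x
    rw [abs_of_pos (W_pos hd x), rpow_sub_one (W_pos hd x).ne']
    field_simp [(W_pos hd x).ne']
  have hgrad : ∀ x, gradient (fun x => W d x + v x) x = gradW d x + gradient v x := by
    intro x
    refine HasGradientAt.gradient ?_
    rw [hasGradientAt_iff_hasFDerivAt, map_add]
    exact (hasGradientAt_W hd x).hasFDerivAt.add (hv x).hasGradientAt.hasFDerivAt
  have hI : Integrable (fun x => inner ℝ (gradW d x) (gradient v x)) :=
    (integrable_inner_gradW hd hB).mono'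
      (Measurable.aestronglyMeasurable (by fun_prop)) (ae_of_all _ fun x => norm_inner_le_norm _ _)
  rw [gradSq]
  simp only [hgrad, norm_add_sq_real]
  have hadd : Integrable (fun x => ‖gradW d x‖ ^ 2 + 2 * inner ℝ (gradW d x) (gradient v x)) :=
    (integrable_norm_gradW_sq hd).add (hI.const_mul 2)
  rw [integral_add hadd hB,
    integral_add (integrable_norm_gradW_sq hd) (hI.const_mul 2), integral_const_mul, hW,
    integral_inner_gradW hd hv hB hA, gradSq]

theorem abs_lpP_W_add_sub_le {d : ℕ} (hd : 3 ≤ d) {v : Rd d → ℝ} (hv : Measurable v)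
    (hA : Integrable (fun x => |v x| ^ pstar d)) :
    |lpP d (fun x => W d x + v x) - lpP d (W d)
        - pstar d * ∫ x, W d x ^ (pstar d - 1) * v x|
      ≤ taylorConst (pstar d) *
        (lpP d (W d) ^ ((pstar d - 2) / pstar d) * lpP d v ^ (2 / pstar d) + lpP d v) := by
  have hp2 := two_lt_pstar hd
  have hW := integrable_W_rpow_pstar hd
  have hL := (integrable_W_rpow_mul hd hv hA).const_mul (pstar d)
  obtain ⟨hQ, hQle⟩ := integrable_and_integral_W_rpow_mul_sq_le hd hv hA
  have hmaj : Integrable (fun x => taylorConst (pstar d) *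
      (W d x ^ (pstar d - 2) * |v x| ^ (2 : ℝ) + |v x| ^ pstar d)) := (hQ.add hA).const_mul (taylorConst (pstar d))
  have hpt := fun x => abs_rpow_add_sub_le hp2 (W_pos hd x) (v x)
  have hrem : Integrable (fun x => |W d x + v x| ^ pstar d - W d x ^ pstar d
      - pstar d * (W d x ^ (pstar d - 1) * v x)) :=
    hmaj.mono' (Measurable.aestronglyMeasurable (by fun_prop)) (ae_of_all _ hpt)
  have hsum : Integrable (fun x => |W d x + v x| ^ pstar d) := by
    refine ((hrem.add hL).add hW).congr (ae_of_all _ fun x => ?_)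
    simp only [Pi.add_apply]; ring
  have hWl : lpP d (W d) = ∫ x, W d x ^ pstar d := by
    simp only [lpP, abs_of_pos (W_pos hd _)]
  have heq : lpP d (fun x => W d x + v x) - lpP d (W d)
        - pstar d * ∫ x, W d x ^ (pstar d - 1) * v x
      = ∫ x, (|W d x + v x| ^ pstar d - W d x ^ pstar d
          - pstar d * (W d x ^ (pstar d - 1) * v x)) := by
    have hsub : Integrable (fun x => |W d x + v x| ^ pstar d - W d x ^ pstar d) := hsum.sub hW
    rw [integral_sub hsub hL, integral_sub hsum hW, integral_const_mul, hWl, lpP]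
  rw [heq]
  calc _ ≤ ∫ x, taylorConst (pstar d) *
        (W d x ^ (pstar d - 2) * |v x| ^ (2 : ℝ) + |v x| ^ pstar d) :=
        abs_integral_le_integral_abs.trans (integral_mono hrem.abs hmaj hpt)
    _ ≤ _ := by
        rw [integral_const_mul, integral_add hQ hA]
        refine mul_le_mul_of_nonneg_left ?_ (taylorConst_nonneg hp2)
        exact add_le_add_left hQle _

theorem lpP_le_of_gradSq_le_one {d : ℕ} (hd : 3 ≤ d) {v : Rd d → ℝ} (hv : Differentiable ℝ v)
    (hB : Integrable (fun x => ‖gradient v x‖ ^ 2)) (hA : Integrable (fun x => |v x| ^ pstar d))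
    (h1 : gradSq d v ≤ 1) :
    lpP d v ≤ ((2 * ((d : ℝ) - 1) / (d - 2)) ^ 2) ^ (pstar d / 2) * gradSq d v := by
  have hp2 := two_lt_pstar hd
  have hA0 : 0 ≤ lpP d v := integral_nonneg fun x => by positivity
  have hB0 : 0 ≤ gradSq d v := integral_nonneg fun x => by positivity
  have h := rpow_le_rpow (by positivity) (lpP_rpow_le_gradSq hd hv hB hA)
    (z := pstar d / 2) (by linarith)
  rw [← rpow_mul hA0, show 2 / pstar d * (pstar d / 2) = 1 by field_simp, rpow_one,
    mul_rpow (by positivity) hB0] at h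
  refine h.trans ?_
  gcongr
  exact rpow_le_self_of_le_one hB0 h1 (by linarith)

theorem stmt_17 (d : ℕ) (hd : 3 ≤ d) :
    ∃ C : ℝ, ∀ v : Rd d → ℝ,
      Differentiable ℝ v →
      Integrable (fun x => ‖gradient v x‖^2) →
      Integrable (fun x => |v x| ^ pstar d) →
      gradSq d v ≤ 1 →
      |Kf d (fun x => W d x + v x)
        - (-(pstar d - 2) * ∫ x, (W d x) ^ (pstar d - 1) * v x)| ≤ C * gradSq d v := by
  set S : ℝ := (2 * ((d : ℝ) - 1) / (d - 2)) ^ 2 with hS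
  set M : ℝ := lpP d (W d) ^ ((pstar d - 2) / pstar d) with hM
  refine ⟨1 + taylorConst (pstar d) * (M * S + S ^ (pstar d / 2)), fun v hv hB hA h1 => ?_⟩
  have hB0 : 0 ≤ gradSq d v := integral_nonneg fun x => by positivity
  have hM0 : 0 ≤ M := rpow_nonneg (integral_nonneg fun x => by positivity) _
  have hR := abs_lpP_W_add_sub_le hd hv.continuous.measurable hA
  have hle : M * lpP d v ^ (2 / pstar d) + lpP d v
      ≤ M * (S * gradSq d v) + S ^ (pstar d / 2) * gradSq d v :=
    add_le_add (mul_le_mul_of_nonneg_left (lpP_rpow_le_gradSq hd hv hB hA) hM0)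
      (lpP_le_of_gradSq_le_one hd hv hB hA h1)
  have hR' := hR.trans
    (mul_le_mul_of_nonneg_left hle (taylorConst_nonneg (two_lt_pstar hd)))
  rw [Kf, gradSq_W_add hd hv hB hA]
  rw [abs_le] at hR' ⊢
  constructor <;> nlinarith [hR'.1, hR'.2]
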